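/- arXiv:1607.02491 — 11 statements merged into one kernel-verified Lean document; each statement's English description precedes it below -/
import Mathlib

section
/- Let A be an associative unital ℂ-algebra and let (ξ, x, η) be a triple of elements of A satisfying the SP_q^{1|2}-relations. Then the quantum supersphere element r := s⁻¹·ξ·η + x² − s·η·ξ commutes with each of ξ, x and η (hence with the subalgebra they generate). -/
/-- A triple `(ξ, x, η)` in a unital associative ℂ-algebra `A` satisfies the
`SP_q^{1|2}`-relations (with `s` a fixed square root of `q`). -/
def SPRel {A : Type*} [Ring A] [Algebra ℂ A] (q s : ℂ) (ξ x η : A) : Prop :=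
  x * ξ = q • (ξ * x) ∧
  x * η = q⁻¹ • (η * x) ∧
  η * ξ = (-(q ^ 2)) • (ξ * η) + (s * (1 - q)) • x ^ 2 ∧
  ξ ^ 2 = 0 ∧ η ^ 2 = 0

theorem stmt2 {A : Type*} [Ring A] [Algebra ℂ A] (q s : ℂ) (hq : q ≠ 0) (hs : s ^ 2 = q)
    (ξ x η : A) (hrel : SPRel q s ξ x η)
    (r : A) (hr : r = s⁻¹ • (ξ * η) + x ^ 2 - s • (η * ξ)) :
    Commute r ξ ∧ Commute r x ∧ Commute r η := by
  obtain ⟨h1, h2, h3, h4, h5⟩ := hrel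
  have hs0 : s ≠ 0 := by
    rintro rfl
    exact hq (by rw [← hs]; simp)
  rw [pow_two] at h4 h5
  have e1 : x ^ 2 * ξ = (q ^ 2) • (ξ * x ^ 2) := by
    rw [pow_two, mul_assoc, h1, mul_smul_comm, ← mul_assoc, h1, smul_mul_assoc, smul_smul,
      mul_assoc, ← pow_two q]
  have e2 : x ^ 2 * η = (q⁻¹ ^ 2) • (η * x ^ 2) := by
    rw [pow_two, mul_assoc, h2, mul_smul_comm, ← mul_assoc, h2, smul_mul_assoc, smul_smul,
      mul_assoc, ← pow_two q⁻¹]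
  have e3 : ξ * (η * ξ) = (s * (1 - q)) • (ξ * x ^ 2) := by
    rw [h3, mul_add, mul_smul_comm, mul_smul_comm, ← mul_assoc, h4, zero_mul, smul_zero, zero_add]
  have e4 : η * (ξ * η) = (s * (1 - q) * q⁻¹ ^ 2) • (η * x ^ 2) := by
    rw [← mul_assoc, h3, add_mul, smul_mul_assoc, smul_mul_assoc, mul_assoc ξ, h5, mul_zero,
      smul_zero, zero_add, e2, smul_smul]
  have e5 : x * (ξ * η) = ξ * η * x := by
    rw [← mul_assoc, h1, smul_mul_assoc, mul_assoc, h2, mul_smul_comm, smul_smul,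
      mul_inv_cancel₀ hq, one_smul, mul_assoc]
  have e6 : x * (η * ξ) = η * ξ * x := by
    rw [← mul_assoc, h2, smul_mul_assoc, mul_assoc, h1, mul_smul_comm, smul_smul,
      inv_mul_cancel₀ hq, one_smul, mul_assoc]
  subst hr
  refine ⟨?_, ?_, ?_⟩
  · have l : (s⁻¹ • (ξ * η) + x ^ 2 - s • (η * ξ)) * ξ
        = (s⁻¹ * (s * (1 - q)) + q ^ 2) • (ξ * x ^ 2) := by
      rw [sub_mul, add_mul, smul_mul_assoc, smul_mul_assoc, mul_assoc, mul_assoc, h4, e3, e1,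
        mul_zero, smul_zero, sub_zero, smul_smul, ← add_smul]
    have r : ξ * (s⁻¹ • (ξ * η) + x ^ 2 - s • (η * ξ))
        = (1 - s * (s * (1 - q))) • (ξ * x ^ 2) := by
      rw [mul_sub, mul_add, mul_smul_comm, mul_smul_comm, e3, ← mul_assoc, h4, zero_mul,
        smul_zero, zero_add, smul_smul, sub_smul, one_smul]
    rw [Commute, SemiconjBy, l, r]
    congr 1
    rw [← hs]
    field_simp
    ring
  · rw [Commute, SemiconjBy, sub_mul, add_mul, mul_sub, mul_add, smul_mul_assoc, smul_mul_assoc,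
      mul_smul_comm, mul_smul_comm, e5, e6, ← pow_succ, ← pow_succ']
  · have l : (s⁻¹ • (ξ * η) + x ^ 2 - s • (η * ξ)) * η
        = (q⁻¹ ^ 2 - s * (s * (1 - q) * q⁻¹ ^ 2)) • (η * x ^ 2) := by
      rw [sub_mul, add_mul, smul_mul_assoc, smul_mul_assoc, mul_assoc, mul_assoc, h5, e4, e2,
        mul_zero, smul_zero, zero_add, smul_smul, ← sub_smul]
    have r : η * (s⁻¹ • (ξ * η) + x ^ 2 - s • (η * ξ))
        = (s⁻¹ * (s * (1 - q) * q⁻¹ ^ 2) + 1) • (η * x ^ 2) := by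
      rw [mul_sub, mul_add, mul_smul_comm, mul_smul_comm, e4, ← mul_assoc η η, h5, zero_mul,
        smul_zero, sub_zero, smul_smul, add_smul, one_smul]
    rw [Commute, SemiconjBy, l, r]
    congr 1
    rw [← hs]
    field_simp
    ring
end

section
/- Let A be an associative unital ℂ-algebra and let (ξ, x, η) be a triple of elements of A satisfying the SP_q^{1|2}-relations (with parameters q and s, s² = q). Then the triple (η, i·x, ξ), where i is the imaginary unit, satisfies the SP_{q⁻¹}^{1|2}-relations with parameters q⁻¹ and s⁻¹. (This is the statement that the defining relations are invariant under replacing q by q⁻¹, x by √−1·x and interchanging ξ with η.) -/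
theorem stmt3 {A : Type*} [Ring A] [Algebra ℂ A] (q s : ℂ) (hq : q ≠ 0) (hs : s ^ 2 = q)
    (ξ x η : A) (hrel : SPRel q s ξ x η) :
    SPRel q⁻¹ s⁻¹ η (Complex.I • x) ξ := by
  have hs0 : s ≠ 0 := by
    rintro rfl
    exact hq (by rw [← hs]; simp)
  obtain ⟨h1, h2, h3, h4, h5⟩ := hrel
  refine ⟨?_, ?_, ?_, h5, h4⟩
  · rw [smul_mul_assoc, mul_smul_comm, h2, smul_comm]
  · rw [smul_mul_assoc, mul_smul_comm, h1, smul_comm, inv_inv]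
  · have e1 : -(q⁻¹ ^ 2) * -(q ^ 2) = 1 := by field_simp
    have e2 : -(q⁻¹ ^ 2) * (s * (1 - q)) + s⁻¹ * (1 - q⁻¹) * Complex.I ^ 2 = 0 := by
      rw [Complex.I_sq]
      subst hs
      field_simp
      ring
    rw [h3, smul_pow, smul_add, smul_smul, smul_smul, smul_smul, e1, one_smul, add_assoc,
      ← add_smul, e2, zero_smul, add_zero]
end

section
/- Let A be an associative unital ℂ-algebra and let (θ, y, z) be a triple of elements of A satisfying the exterior SP_q^{1|2}-relations with parameters q and s (s² = q). Then the triple (i·θ, z, y), where i is the imaginary unit, satisfies the exterior SP_{q⁻¹}^{1|2}-relations with parameters q⁻¹ and s⁻¹. (This is the statement that the exterior relations are invariant under replacing q by q⁻¹, θ by √−1·θ and interchanging y with z.) -/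
/-- A triple `(θ, y, z)` in a unital associative ℂ-algebra `A` satisfies the exterior
`SP_q^{1|2}`-relations (with `s` a fixed square root of `q`). -/
def ExtRel {A : Type*} [Ring A] [Algebra ℂ A] (q s : ℂ) (θ y z : A) : Prop :=
  θ * y = q⁻¹ • (y * θ) ∧
  θ * z = q • (z * θ) ∧
  y * z = (q ^ 2) • (z * y) ∧
  θ ^ 2 = (s * (q - 1)) • (z * y)

theorem stmt4 {A : Type*} [Ring A] [Algebra ℂ A] (q s : ℂ) (hq : q ≠ 0) (hs : s ^ 2 = q)
    (θ y z : A) (hrel : ExtRel q s θ y z) :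
    ExtRel q⁻¹ s⁻¹ (Complex.I • θ) z y := by
  obtain ⟨h1, h2, h3, h4⟩ := hrel
  have hs0 : s ≠ 0 := by
    rintro rfl
    apply hq
    rw [← hs]
    norm_num
  refine ⟨?_, ?_, ?_, ?_⟩
  · rw [inv_inv, smul_mul_assoc, mul_smul_comm, h2, smul_comm]
  · rw [smul_mul_assoc, mul_smul_comm, h1, smul_comm]
  · rw [h3, smul_smul, ← mul_pow, inv_mul_cancel₀ hq, one_pow, one_smul]
  · rw [smul_pow, Complex.I_sq, h4, h3, smul_smul, smul_smul]
    congr 1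
    subst hs
    field_simp
    ring
end

section
/- Let A be an associative unital ℂ-algebra and let (ξ, x, η) be a triple of elements of A satisfying the SP_q^{1|2}-relations with parameters q and s (s² = q). Then the triple (s·η, x, −s⁻¹·ξ) satisfies the SP_{q⁻¹}^{1|2}-relations with parameters q⁻¹ and s⁻¹. (This encodes the statement that the assignment ξ* = q^{1/2}η, x* = x, η* = −q^{−1/2}ξ defines a Z₂-graded involution making O(SP_q^{1|2}) a super *-algebra for real q > 0.) -/
theorem stmt5 {A : Type*} [Ring A] [Algebra ℂ A] (q s : ℂ) (hq : q ≠ 0) (hs : s ^ 2 = q)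
    (ξ x η : A) (hrel : SPRel q s ξ x η) :
    SPRel q⁻¹ s⁻¹ (s • η) x ((-s⁻¹) • ξ) := by
  have hs0 : s ≠ 0 := by
    rintro rfl
    exact hq (by rw [← hs]; simp)
  subst hs
  obtain ⟨h1, h2, h3, h4, h5⟩ := hrel
  refine ⟨?_, ?_, ?_, ?_, ?_⟩
  · rw [mul_smul_comm, h2, smul_mul_assoc, smul_comm]
  · rw [mul_smul_comm, h1, smul_mul_assoc, smul_comm, inv_inv]
  · simp only [smul_mul_assoc, mul_smul_comm, h3, smul_add, smul_smul]
    rw [add_assoc, ← add_smul]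
    have e1 : -(((s ^ 2)⁻¹) ^ 2) * (s * (-s⁻¹ * (s * (1 - s ^ 2)))) + s⁻¹ * (1 - (s ^ 2)⁻¹) = 0 := by
      field_simp
      ring
    have e2 : -(((s ^ 2)⁻¹) ^ 2) * (s * (-s⁻¹ * -((s ^ 2) ^ 2))) = -s⁻¹ * s := by
      field_simp
    first
      | (match_scalars <;> field_simp <;> ring)
      | (simp only [mul_assoc] at *; simp [e1, e2])
  · rw [smul_pow, h5, smul_zero]
  · rw [smul_pow, h4, smul_zero]
end

section
/- Let A be an associative unital ℂ-algebra containing elements ξ, x, η, dξ, dx, dη such that (ξ, x, η) satisfies the SP_q^{1|2}-relations and the first-order calculus relations (13) hold. Then the quantum supersphere r := s⁻¹·ξ·η + x² − s·η·ξ satisfies r·dx = q²·dx·r, r·dξ = q²·dξ·r and r·dη = q²·dη·r (equivalently, dxᵢ·r = q⁻²·r·dxᵢ for each of the three differentials). -/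
theorem stmt7 {A : Type*} [Ring A] [Algebra ℂ A] (q s : ℂ) (hq : q ≠ 0) (hs : s ^ 2 = q)
    (ξ x η dξ dx dη : A) (hrel : SPRel q s ξ x η)
    (h1 : x * dx = q • (dx * x) + (s * (q ^ 2 - 1)) • (dη * ξ))
    (h2 : x * dξ = q • (dξ * x) + (q ^ 2 - 1) • (dx * ξ))
    (h3 : x * dη = q • (dη * x))
    (h4 : ξ * dx = (-q) • (dx * ξ))
    (h5 : ξ * dξ = dξ * ξ)
    (h6 : ξ * dη = (q ^ 2) • (dη * ξ))
    (h7 : η * dx = (-q) • (dx * η) + (1 - q ^ 2) • (dη * x))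
    (h8 : η * dξ = (q ^ 2) • (dξ * η) + (1 - q ^ 2) • ((1 + q) • (dη * ξ) - s • (dx * x)))
    (h9 : η * dη = dη * η)
    (r : A) (hr : r = s⁻¹ • (ξ * η) + x ^ 2 - s • (η * ξ)) :
    r * dx = (q ^ 2) • (dx * r) ∧ r * dξ = (q ^ 2) • (dξ * r) ∧
      r * dη = (q ^ 2) • (dη * r) := by
  obtain ⟨e1, -, -, e4, -⟩ := hrel
  have hs0 : s ≠ 0 := by
    rintro rfl
    apply hq
    rw [← hs]
    norm_num
  subst hs
  have push : ∀ {a b c : A}, a * b = c → ∀ z, a * (b * z) = c * z := by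
    intro a b c h z
    rw [← mul_assoc, h]
  rw [pow_two] at e4
  have g1 := push h1
  have g2 := push h2
  have g3 := push h3
  have g4 := push h4
  have g5 := push h5
  have g6 := push h6
  have g7 := push h7
  have g8 := push h8
  have g9 := push h9
  subst hr
  refine ⟨?_, ?_, ?_⟩
  all_goals
    simp only [pow_two x, add_mul, sub_mul, mul_add, mul_sub, smul_mul_assoc, mul_smul_comm,
      mul_assoc, h1, h2, h3, h4, h5, h6, h7, h8, h9, g1, g2, g3, g4, g5, g6, g7, g8, g9, e1, e4,
      mul_zero, smul_zero]
    match_scalars <;> field_simp <;> ring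
end

section
/- Let D be the quotient of the free associative ℂ-algebra on generators ∂ξ, ∂x, ∂η by the two-sided ideal generated by ∂x·∂ξ − q⁻¹·∂ξ·∂x, ∂x·∂η − q·∂η·∂x, ∂ξ², ∂η², and ∂ξ·∂η + q²·∂η·∂ξ − s·(q−1)·∂x², where q ∈ ℂ is nonzero and s² = q. Then the images of the ordered monomials ∂x^k·∂ξ^l·∂η^m, with k ∈ ℕ and l, m ∈ {0, 1}, form a basis of D as a ℂ-vector space. -/
open FreeAlgebra

/-- The defining relations of the algebra `D` of partial derivatives on the free
algebra over generators `∂ξ = ι 0`, `∂x = ι 1`, `∂η = ι 2` (with `s` playing the role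
of `q^{1/2}`): `∂x·∂ξ = q⁻¹·∂ξ·∂x`, `∂x·∂η = q·∂η·∂x`, `∂ξ² = 0`, `∂η² = 0`,
`∂ξ·∂η = −q²·∂η·∂ξ + s·(q−1)·∂x²`. -/
inductive DRel (q s : ℂ) : FreeAlgebra ℂ (Fin 3) → FreeAlgebra ℂ (Fin 3) → Prop
  | rel1 : DRel q s (ι ℂ (1 : Fin 3) * ι ℂ (0 : Fin 3)) (q⁻¹ • (ι ℂ (0 : Fin 3) * ι ℂ (1 : Fin 3)))
  | rel2 : DRel q s (ι ℂ (1 : Fin 3) * ι ℂ (2 : Fin 3)) (q • (ι ℂ (2 : Fin 3) * ι ℂ (1 : Fin 3)))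
  | rel3 : DRel q s ((ι ℂ (0 : Fin 3)) ^ 2) 0
  | rel4 : DRel q s ((ι ℂ (2 : Fin 3)) ^ 2) 0
  | rel5 : DRel q s (ι ℂ (0 : Fin 3) * ι ℂ (2 : Fin 3))
      ((-(q ^ 2)) • (ι ℂ (2 : Fin 3) * ι ℂ (0 : Fin 3)) + (s * (q - 1)) • (ι ℂ (1 : Fin 3)) ^ 2)

/-- `D`: the quotient of the free algebra on `∂ξ, ∂x, ∂η` by the two-sided ideal
generated by the defining relations. -/
abbrev DAlg (q s : ℂ) := RingQuot (DRel q s)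

/-- The image in `D` of the ordered monomial `∂x^k·∂ξ^l·∂η^m`. -/
noncomputable def dmono (q s : ℂ) : ℕ × Fin 2 × Fin 2 → DAlg q s :=
  fun t => RingQuot.mkAlgHom ℂ (DRel q s)
    ((ι ℂ (1 : Fin 3)) ^ t.1 * (ι ℂ (0 : Fin 3)) ^ (t.2.1 : ℕ) * (ι ℂ (2 : Fin 3)) ^ (t.2.2 : ℕ))

namespace DAux

abbrev V := (ℕ × Fin 2 × Fin 2) →₀ ℂ

noncomputable def e (k : ℕ) (l m : Fin 2) : V := Finsupp.single (k, l, m) 1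

noncomputable def aX : V →ₗ[ℂ] V :=
  Finsupp.linearCombination ℂ (fun t => e (t.1 + 1) t.2.1 t.2.2)

noncomputable def aXi (q : ℂ) : V →ₗ[ℂ] V :=
  Finsupp.linearCombination ℂ (fun t => if t.2.1 = 0 then q ^ t.1 • e t.1 1 t.2.2 else 0)

noncomputable def aEta (q s : ℂ) : V →ₗ[ℂ] V :=
  Finsupp.linearCombination ℂ (fun t =>
    if t.2.1 = 0 then (if t.2.2 = 0 then (q⁻¹) ^ t.1 • e t.1 0 1 else 0)
    else (if t.2.2 = 0 then (-((q⁻¹) ^ t.1 * (q⁻¹) ^ 2)) • e t.1 1 1 else 0)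
      + ((q⁻¹) ^ t.1 * (q⁻¹) ^ 2 * (s * (q - 1))) • e (t.1 + 2) 0 t.2.2)

lemma aX_e (k l m) : aX (e k l m) = e (k + 1) l m := by simp [aX, e]
lemma aXi_e0 (q k m) : aXi q (e k 0 m) = q ^ k • e k 1 m := by simp [aXi, e]
lemma aXi_e1 (q k m) : aXi q (e k 1 m) = 0 := by simp [aXi, e]
lemma aEta_00 (q s k) : aEta q s (e k 0 0) = (q⁻¹) ^ k • e k 0 1 := by simp [aEta, e]
lemma aEta_01 (q s k) : aEta q s (e k 0 1) = 0 := by simp [aEta, e]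
lemma aEta_10 (q s k) : aEta q s (e k 1 0) = (-((q⁻¹) ^ k * (q⁻¹) ^ 2)) • e k 1 1
    + ((q⁻¹) ^ k * (q⁻¹) ^ 2 * (s * (q - 1))) • e (k + 2) 0 0 := by
  simp [aEta, e]
lemma aEta_11 (q s k) : aEta q s (e k 1 1) =
    ((q⁻¹) ^ k * (q⁻¹) ^ 2 * (s * (q - 1))) • e (k + 2) 0 1 := by
  simp [aEta, e]

lemma ext_e {f g : V →ₗ[ℂ] V} (h : ∀ k l m, f (e k l m) = g (e k l m)) : f = g := by
  apply Finsupp.lhom_ext'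
  rintro ⟨k, l, m⟩
  apply LinearMap.ext_ring
  exact h k l m

noncomputable def act (q s : ℂ) : FreeAlgebra ℂ (Fin 3) →ₐ[ℂ] Module.End ℂ V :=
  FreeAlgebra.lift ℂ ![aXi q, aX, aEta q s]

lemma act0 (q s) : act q s (ι ℂ (0 : Fin 3)) = aXi q := by simp [act]
lemma act1 (q s) : act q s (ι ℂ (1 : Fin 3)) = aX := by simp [act]
lemma act2 (q s) : act q s (ι ℂ (2 : Fin 3)) = aEta q s := by simp [act]

lemma act_rel (q s : ℂ) (hq : q ≠ 0) ⦃a b : FreeAlgebra ℂ (Fin 3)⦄ (h : DRel q s a b) :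
    act q s a = act q s b := by
  cases h <;>
  · simp only [map_mul, map_smul, map_add, map_pow, map_zero, act0, act1, act2]
    apply ext_e
    intro k l m
    fin_cases l <;> fin_cases m <;>
      simp [pow_two, aX_e, aXi_e0, aXi_e1, aEta_00, aEta_01, aEta_10, aEta_11, smul_smul] <;>
      (try simp only [← add_smul, ← sub_smul, ← neg_smul, ← smul_assoc, smul_eq_mul]) <;>
      (try match_scalars) <;> (try field_simp) <;> (try ring)

noncomputable def rep (q s : ℂ) (hq : q ≠ 0) : DAlg q s →ₐ[ℂ] Module.End ℂ V :=
  RingQuot.liftAlgHom ℂ ⟨act q s, act_rel q s hq⟩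

lemma aX_pow (k j l m) : (aX ^ k) (e j l m) = e (j + k) l m := by
  induction k with
  | zero => simp
  | succ k ih => rw [pow_succ', Module.End.mul_apply, ih, aX_e, add_assoc]

lemma rep_dmono (q s : ℂ) (hq : q ≠ 0) (t) :
    rep q s hq (dmono q s t) (e 0 0 0) = Finsupp.single t 1 := by
  obtain ⟨k, l, m⟩ := t
  simp only [rep, dmono, RingQuot.liftAlgHom_mkAlgHom_apply, map_mul, map_pow, act0, act1, act2]
  change _ = e k l m
  fin_cases l <;> fin_cases m <;>
    simp [aX_pow, aXi_e0, aEta_00]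

section span
variable (q s : ℂ)

noncomputable def g (i : Fin 3) : DAlg q s := RingQuot.mkAlgHom ℂ (DRel q s) (ι ℂ i)

lemma dmono_eq (k : ℕ) (l m : Fin 2) :
    dmono q s (k, l, m) = g q s 1 ^ k * g q s 0 ^ (l : ℕ) * g q s 2 ^ (m : ℕ) := by
  simp [dmono, g]

lemma r1 : g q s 1 * g q s 0 = q⁻¹ • (g q s 0 * g q s 1) := by
  simpa [g] using RingQuot.mkAlgHom_rel ℂ (DRel.rel1 (q := q) (s := s))
lemma r2 : g q s 1 * g q s 2 = q • (g q s 2 * g q s 1) := by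
  simpa [g] using RingQuot.mkAlgHom_rel ℂ (DRel.rel2 (q := q) (s := s))
lemma r3 : g q s 0 * g q s 0 = 0 := by
  simpa [g, pow_two] using RingQuot.mkAlgHom_rel ℂ (DRel.rel3 (q := q) (s := s))
lemma r4 : g q s 2 * g q s 2 = 0 := by
  simpa [g, pow_two] using RingQuot.mkAlgHom_rel ℂ (DRel.rel4 (q := q) (s := s))
lemma r5 : g q s 0 * g q s 2 = (-(q ^ 2)) • (g q s 2 * g q s 0) + (s * (q - 1)) • g q s 1 ^ 2 := by
  have := RingQuot.mkAlgHom_rel ℂ (DRel.rel5 (q := q) (s := s))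
  simpa only [g, map_mul, map_add, map_smul, map_pow] using this

lemma c0 (hq : q ≠ 0) (k : ℕ) : g q s 0 * g q s 1 ^ k = q ^ k • (g q s 1 ^ k * g q s 0) := by
  induction k with
  | zero => simp
  | succ k ih =>
    have h : g q s 0 * g q s 1 = q • (g q s 1 * g q s 0) := by
      rw [r1, smul_smul, mul_inv_cancel₀ hq, one_smul]
    rw [pow_succ, ← mul_assoc, ih, smul_mul_assoc, mul_assoc, h, mul_smul_comm, smul_smul,
      ← mul_assoc, pow_succ]

lemma c2 (hq : q ≠ 0) (k : ℕ) : g q s 2 * g q s 1 ^ k = q⁻¹ ^ k • (g q s 1 ^ k * g q s 2) := by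
  induction k with
  | zero => simp
  | succ k ih =>
    have h : g q s 2 * g q s 1 = q⁻¹ • (g q s 1 * g q s 2) := by
      rw [r2, smul_smul, inv_mul_cancel₀ hq, one_smul]
    rw [pow_succ, ← mul_assoc, ih, smul_mul_assoc, mul_assoc, h, mul_smul_comm, smul_smul,
      ← mul_assoc, pow_succ]

lemma r5' (hq : q ≠ 0) : g q s 2 * g q s 0 =
    (-(q⁻¹ ^ 2)) • (g q s 0 * g q s 2) + (q⁻¹ ^ 2 * (s * (q - 1))) • g q s 1 ^ 2 := by
  rw [r5]
  match_scalars <;> field_simp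
  ring

abbrev W : Submodule ℂ (DAlg q s) := Submodule.span ℂ (Set.range (dmono q s))

lemma mem (k : ℕ) (l m : Fin 2) :
    g q s 1 ^ k * g q s 0 ^ (l : ℕ) * g q s 2 ^ (m : ℕ) ∈ W q s := by
  rw [← dmono_eq]; exact Submodule.subset_span ⟨_, rfl⟩

lemma gen_mem (hq : q ≠ 0) (i : Fin 3) (t) : g q s i * dmono q s t ∈ W q s := by
  obtain ⟨k, l, m⟩ := t
  have m00 := fun k => mem q s k 0 0
  have m01 := fun k => mem q s k 0 1
  have m10 := fun k => mem q s k 1 0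
  have m11 := fun k => mem q s k 1 1
  simp only [Fin.val_zero, Fin.val_one, pow_zero, pow_one, mul_one] at m00 m01 m10 m11
  rw [dmono_eq]
  have hi : i = 0 ∨ i = 1 ∨ i = 2 := by fin_cases i <;> simp
  rcases hi with rfl | rfl | rfl
  · rw [← mul_assoc, ← mul_assoc, c0 q s hq, smul_mul_assoc, smul_mul_assoc]
    apply Submodule.smul_mem
    rw [mul_assoc (g q s 1 ^ k)]
    fin_cases l
    · fin_cases m <;> simp [m10, m11]
    · simp [r3]
  · rw [← mul_assoc, ← mul_assoc, ← pow_succ']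
    exact mem q s (k + 1) l m
  · rw [← mul_assoc, ← mul_assoc, c2 q s hq, smul_mul_assoc, smul_mul_assoc]
    apply Submodule.smul_mem
    rw [mul_assoc (g q s 1 ^ k)]
    fin_cases l
    · fin_cases m
      · simp [m01]
      · simp [mul_assoc, r4]
    · simp only [Fin.mk_one, Fin.val_one, pow_one]
      rw [r5' q s hq, mul_add, add_mul, mul_smul_comm, mul_smul_comm, smul_mul_assoc,
        smul_mul_assoc, ← pow_add]
      apply Submodule.add_mem
      · apply Submodule.smul_mem
        fin_cases m
        · simpa [mul_assoc] using m11 k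
        · simp [mul_assoc, r4]
      · apply Submodule.smul_mem
        fin_cases m
        · simpa using m00 (k + 2)
        · simpa using m01 (k + 2)

lemma gen_mul (hq : q ≠ 0) (i : Fin 3) (w) (hw : w ∈ W q s) : g q s i * w ∈ W q s := by
  induction hw using Submodule.span_induction with
  | mem x hx => obtain ⟨t, rfl⟩ := hx; exact gen_mem q s hq i t
  | zero => simp
  | add x y _ _ hx hy => rw [mul_add]; exact Submodule.add_mem _ hx hy
  | smul a x _ hx => rw [mul_smul_comm]; exact Submodule.smul_mem _ _ hx

lemma all_mul (hq : q ≠ 0) (a : FreeAlgebra ℂ (Fin 3)) :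
    ∀ w ∈ W q s, RingQuot.mkAlgHom ℂ (DRel q s) a * w ∈ W q s := by
  induction a using FreeAlgebra.induction with
  | grade0 r =>
    intro w hw
    rw [AlgHom.commutes, ← Algebra.smul_def]
    exact Submodule.smul_mem _ _ hw
  | grade1 i => exact gen_mul q s hq i
  | mul a b ha hb => intro w hw; rw [map_mul, mul_assoc]; exact ha _ (hb _ hw)
  | add a b ha hb =>
    intro w hw; rw [map_add, add_mul]; exact Submodule.add_mem _ (ha _ hw) (hb _ hw)

end span

end DAux

/-- The monomials `∂x^k·∂ξ^l·∂η^m` (`k ∈ ℕ`, `l, m ∈ {0,1}`) form a ℂ-vector space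
basis of `D`: they are linearly independent and they span. -/
theorem stmt10 (q s : ℂ) (hq : q ≠ 0) (hs : s ^ 2 = q) :
    LinearIndependent ℂ (dmono q s) ∧
      Submodule.span ℂ (Set.range (dmono q s)) = ⊤ := by
  constructor
  · let f : DAlg q s →ₗ[ℂ] DAux.V :=
      (LinearMap.applyₗ (DAux.e 0 0 0)).comp (DAux.rep q s hq).toLinearMap
    apply LinearIndependent.of_comp f
    have : f ∘ dmono q s = fun t => Finsupp.single t (1 : ℂ) := by
      funext t
      exact DAux.rep_dmono q s hq t
    rw [this]
    have h := (Finsupp.basisSingleOne (R := ℂ) (ι := ℕ × Fin 2 × Fin 2)).linearIndependent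
    simpa using h
  · rw [eq_top_iff]
    rintro x -
    obtain ⟨a, rfl⟩ := RingQuot.mkAlgHom_surjective ℂ (DRel q s) x
    have h1 : (1 : DAlg q s) ∈ DAux.W q s := by simpa using DAux.mem q s 0 0 0
    simpa using DAux.all_mul q s hq a 1 h1
end

section
/- Suppose q ∈ ℂ satisfies q·(q−1)·(q²+1)·(q³+1) ≠ 0 and s² = q. Then the set of eigenvalues of the 9×9 matrix B̂_q is exactly {−1, q², q³}: each of −1, q², q³ is an eigenvalue of B̂_q, and every eigenvalue of B̂_q equals one of them. -/
/-- The 9×9 matrix `B̂_q` of the left-covariant calculus on `SP_q^{1|2}`, with rows and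
columns indexed by pairs in `Fin 3 × Fin 3` (here `s` plays the role of `q^{1/2}`). -/
def Bmat (q s : ℂ) : Matrix (Fin 3 × Fin 3) (Fin 3 × Fin 3) ℂ :=
  Matrix.of fun p r =>
    if p = ((0 : Fin 3), (0 : Fin 3)) ∧ r = ((0 : Fin 3), (0 : Fin 3)) then -1
    else if p = (2, 2) ∧ r = (2, 2) then -1
    else if p = (1, 0) ∧ r = (0, 1) then q
    else if p = (0, 1) ∧ r = (1, 0) then q
    else if p = (1, 1) ∧ r = (1, 1) then q
    else if p = (2, 1) ∧ r = (1, 2) then q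
    else if p = (1, 2) ∧ r = (2, 1) then q
    else if p = (2, 0) ∧ r = (0, 2) then -q ^ 2
    else if p = (0, 2) ∧ r = (2, 0) then -q ^ 2
    else if p = (1, 0) ∧ r = (1, 0) then q ^ 2 - 1
    else if p = (2, 1) ∧ r = (2, 1) then q ^ 2 - 1
    else if p = (2, 0) ∧ r = (1, 1) then s * (q ^ 2 - 1)
    else if p = (1, 1) ∧ r = (2, 0) then -(s * (q ^ 2 - 1))
    else if p = (2, 0) ∧ r = (2, 0) then (1 + q) * (q ^ 2 - 1)
    else 0

lemma Bmat_eig (q s μ : ℂ) (v : Fin 3 × Fin 3 → ℂ) :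
    Matrix.toLin' (Bmat q s) v = μ • v ↔
      (-v (0,0) = μ * v (0,0) ∧ -v (2,2) = μ * v (2,2) ∧
       q * v (1,0) = μ * v (0,1) ∧ q * v (0,1) + (q ^ 2 - 1) * v (1,0) = μ * v (1,0) ∧
       q * v (2,1) = μ * v (1,2) ∧ q * v (1,2) + (q ^ 2 - 1) * v (2,1) = μ * v (2,1) ∧
       -q ^ 2 * v (2,0) = μ * v (0,2) ∧
       q * v (1,1) - s * (q ^ 2 - 1) * v (2,0) = μ * v (1,1) ∧
       -q ^ 2 * v (0,2) + s * (q ^ 2 - 1) * v (1,1) + (1 + q) * (q ^ 2 - 1) * v (2,0)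
         = μ * v (2,0)) := by
  rw [funext_iff, Prod.forall]
  simp only [Fin.forall_fin_succ, Matrix.toLin'_apply, Matrix.mulVec, dotProduct,
    Fintype.sum_prod_type, Fin.sum_univ_three, Bmat, Matrix.of_apply, Pi.smul_apply, smul_eq_mul]
  simp [Prod.ext_iff]
  constructor
  · rintro ⟨⟨h1, h2, h3⟩, ⟨h4, h5, h6⟩, h7, h8, h9⟩
    refine ⟨h1, h9, h2, ?_, h6, ?_, ?_, ?_, ?_⟩ <;> grind
  · rintro ⟨h1, h2, h3, h4, h5, h6, h7, h8, h9⟩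
    refine ⟨⟨h1, h3, ?_⟩, ⟨?_, ?_, h5⟩, ?_, ?_, h2⟩ <;> grind

lemma two_block (q μ a b : ℂ) (hq : q ≠ 0) (h1 : μ ≠ -1) (h2 : μ ≠ q ^ 2)
    (e1 : q * b = μ * a) (e2 : q * a + (q ^ 2 - 1) * b = μ * b) : a = 0 ∧ b = 0 := by
  have hb : (μ + 1) * (μ - q ^ 2) * b = 0 := by
    linear_combination (-μ) * e2 - q * e1
  have h1' : μ + 1 ≠ 0 := fun h => h1 (by linear_combination h)
  have hb0 : b = 0 := by
    simpa [h1', sub_ne_zero.mpr h2] using hb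
  subst hb0
  refine ⟨?_, rfl⟩
  simpa [hq] using e2

/-- Each of `−1`, `q²`, `q³` is an eigenvalue of `B̂_q`, and every eigenvalue of `B̂_q`
is one of these. -/
theorem stmt13 (q s : ℂ) (hq : q * (q - 1) * (q ^ 2 + 1) * (q ^ 3 + 1) ≠ 0)
    (hs : s ^ 2 = q) :
    ∀ μ : ℂ, Module.End.HasEigenvalue (Matrix.toLin' (Bmat q s)) μ ↔
      (μ = -1 ∨ μ = q ^ 2 ∨ μ = q ^ 3) := by
  intro μ
  have hq0 : q ≠ 0 := by rintro rfl; simp at hq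
  have hq1 : q - 1 ≠ 0 := by intro h; simp [h] at hq
  have hqm : q + 1 ≠ 0 := by
    intro h
    apply hq
    linear_combination (q * (q - 1) * (q ^ 2 + 1) * (q ^ 2 - q + 1)) * h
  have hs0 : s ≠ 0 := by rintro rfl; apply hq0; rw [← hs]; simp
  have hk : s * (q ^ 2 - 1) ≠ 0 := by
    have : q ^ 2 - 1 = (q - 1) * (q + 1) := by ring
    rw [this]
    exact mul_ne_zero hs0 (mul_ne_zero hq1 hqm)
  constructor
  · intro h
    obtain ⟨v, hv⟩ := h.exists_hasEigenvector
    have hv0 := hv.2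
    obtain ⟨e1, e2, e3, e4, e5, e6, e7, e8, e9⟩ := (Bmat_eig q s μ v).1 hv.apply_eq_smul
    by_contra! hc
    obtain ⟨h1, h2, h3⟩ := hc
    have h1' : μ + 1 ≠ 0 := fun h => h1 (by linear_combination h)
    have a00 : v (0,0) = 0 := by
      have : (μ + 1) * v (0,0) = 0 := by linear_combination -e1
      simpa [h1'] using this
    have a22 : v (2,2) = 0 := by
      have : (μ + 1) * v (2,2) = 0 := by linear_combination -e2
      simpa [h1'] using this
    obtain ⟨a01, a10⟩ := two_block q μ _ _ hq0 h1 h2 e3 e4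
    obtain ⟨a12, a21⟩ := two_block q μ _ _ hq0 h1 h2 e5 e6
    have a20 : v (2,0) = 0 := by
      have : (μ + 1) * (μ - q ^ 2) * (μ - q ^ 3) * v (2,0) = 0 := by
        linear_combination (-μ * (μ - q)) * e9 + (q ^ 2 * (μ - q)) * e7
          - (s * (q ^ 2 - 1) * μ) * e8 - ((q ^ 2 - 1) ^ 2 * μ * v (2,0)) * hs
      simpa [h1', sub_ne_zero.mpr h2, sub_ne_zero.mpr h3] using this
    rw [a20] at e7 e8 e9
    have a11 : v (1,1) = 0 := by
      by_contra hb
      have hμ : μ = q := by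
        have : (μ - q) * v (1,1) = 0 := by linear_combination -e8
        simpa [hb, sub_eq_zero] using this
      have a02 : v (0,2) = 0 := by
        rw [hμ] at e7
        simpa [hq0] using e7
      rw [a02] at e9
      have : s * (q ^ 2 - 1) * v (1,1) = 0 := by linear_combination e9
      exact (mul_ne_zero hk hb) this
    have a02 : v (0,2) = 0 := by
      rw [a11] at e9
      simpa [hq0] using e9
    apply hv0
    funext ⟨i, j⟩
    fin_cases i <;> fin_cases j <;> simp [*]
  · have key : ∀ v : Fin 3 × Fin 3 → ℂ, v ≠ 0 → Matrix.toLin' (Bmat q s) v = μ • v →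
        Module.End.HasEigenvalue (Matrix.toLin' (Bmat q s)) μ := fun v h0 h =>
      Module.End.hasEigenvalue_of_hasEigenvector (x := v)
        ⟨Module.End.mem_eigenspace_iff.2 h, h0⟩
    rintro (rfl | rfl | rfl)
    · refine key (fun p => !![1, 0, 0; 0, 0, 0; 0, 0, 0] p.1 p.2) ?_ ?_
      · intro h
        simpa using congrFun h (0, 0)
      · rw [Bmat_eig]; simp
    · refine key (fun p => !![0, 1, 0; q, 0, 0; 0, 0, 0] p.1 p.2) ?_ ?_
      · intro h
        simpa using congrFun h (0, 1)
      · rw [Bmat_eig]; simp; grind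
    · refine key (fun p => !![0, 0, 1; 0, s, 0; -q, 0, 0] p.1 p.2) ?_ ?_
      · intro h
        simpa using congrFun h (0, 2)
      · rw [Bmat_eig]; simp; clear key hk hq hqm hq1 hs0 hq0; subst hs; refine ⟨?_, ?_, ?_⟩ <;> ring
end

section
/- Suppose q ∈ ℂ satisfies q·(q−1)·(q²+1)·(q³+1) ≠ 0 and s² = q. Define P₋ := (B̂_q² − (q²+q³)·B̂_q + q⁵·I) / ((q²+1)(q³+1)), P₀ := (B̂_q² + (1−q²)·B̂_q − q²·I) / (q²(q−1)(q³+1)), and P₊ := I − P₋ − P₀. Then P₋, P₊, P₀ are mutually orthogonal idempotents (Pᵢ·Pⱼ = δᵢⱼ·Pⱼ), they sum to the identity matrix, and B̂_q admits the spectral decomposition B̂_q = −P₋ + q²·P₊ + q³·P₀. -/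
noncomputable section

/-- The projector `P₋` from the spectral decomposition of `B̂_q`. -/
def Pminus (q s : ℂ) : Matrix (Fin 3 × Fin 3) (Fin 3 × Fin 3) ℂ :=
  ((q ^ 2 + 1) * (q ^ 3 + 1))⁻¹ •
    (Bmat q s * Bmat q s - (q ^ 2 + q ^ 3) • Bmat q s + (q ^ 5) • 1)

/-- The projector `P₀` from the spectral decomposition of `B̂_q`. -/
def Pzero (q s : ℂ) : Matrix (Fin 3 × Fin 3) (Fin 3 × Fin 3) ℂ :=
  (q ^ 2 * (q - 1) * (q ^ 3 + 1))⁻¹ •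
    (Bmat q s * Bmat q s + (1 - q ^ 2) • Bmat q s - (q ^ 2) • 1)

/-- The projector `P₊ := I − P₋ − P₀`. -/
def Pplus (q s : ℂ) : Matrix (Fin 3 × Fin 3) (Fin 3 × Fin 3) ℂ :=
  1 - Pminus q s - Pzero q s

set_option maxHeartbeats 4000000 in
theorem Bmat_cubic (q s : ℂ) (hs : s ^ 2 = q) :
    Bmat q s * (Bmat q s * Bmat q s) = (q ^ 3 + q ^ 2 - 1) • (Bmat q s * Bmat q s)
      + (q ^ 2 + q ^ 3 - q ^ 5) • Bmat q s - (q ^ 5) • 1 := by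
  subst hs
  ext ⟨i, l⟩ ⟨j, k⟩
  fin_cases i <;> fin_cases l <;> fin_cases j <;> fin_cases k <;>
    simp [Matrix.mul_apply, Fintype.sum_prod_type, Fin.sum_univ_three, Bmat] <;> ring

theorem eig_minus (q s : ℂ) (hs : s ^ 2 = q) :
    Bmat q s * Pminus q s = - Pminus q s := by
  simp only [Pminus, Matrix.mul_smul, mul_add, mul_sub, mul_one, Bmat_cubic q s hs]
  module

theorem eig_zero (q s : ℂ) (hs : s ^ 2 = q) :
    Bmat q s * Pzero q s = (q ^ 3) • Pzero q s := by
  simp only [Pzero, Matrix.mul_smul, mul_add, mul_sub, mul_one, Bmat_cubic q s hs]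
  module

/-- `P₋`, `P₊`, `P₀` are mutually orthogonal idempotents summing to the identity, and
`B̂_q = −P₋ + q²·P₊ + q³·P₀`. -/
theorem stmt14 (q s : ℂ) (hq : q * (q - 1) * (q ^ 2 + 1) * (q ^ 3 + 1) ≠ 0)
    (hs : s ^ 2 = q) :
    (Pminus q s * Pminus q s = Pminus q s ∧
      Pplus q s * Pplus q s = Pplus q s ∧
      Pzero q s * Pzero q s = Pzero q s) ∧
    (Pminus q s * Pplus q s = 0 ∧ Pplus q s * Pminus q s = 0 ∧
      Pminus q s * Pzero q s = 0 ∧ Pzero q s * Pminus q s = 0 ∧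
      Pplus q s * Pzero q s = 0 ∧ Pzero q s * Pplus q s = 0) ∧
    Pminus q s + Pplus q s + Pzero q s = 1 ∧
    Bmat q s = -Pminus q s + (q ^ 2) • Pplus q s + (q ^ 3) • Pzero q s := by
  have h1 := eig_minus q s hs
  have h0 := eig_zero q s hs
  have hq0 : q ≠ 0 := by rintro rfl; simp at hq
  have hq1 : q - 1 ≠ 0 := by intro h; simp [h] at hq
  have hq2 : q ^ 2 + 1 ≠ 0 := by intro h; simp [h] at hq
  have hq3 : q ^ 3 + 1 ≠ 0 := by intro h; simp [h] at hq
  have mm : Pminus q s * Pminus q s = Pminus q s := by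
    conv_lhs => enter [1]; rw [Pminus]
    simp only [Matrix.smul_mul, add_mul, sub_mul, one_mul, mul_assoc, h1, mul_neg, neg_neg]
    match_scalars
    field_simp
    ring
  have zm : Pzero q s * Pminus q s = 0 := by
    conv_lhs => enter [1]; rw [Pzero]
    simp only [Matrix.smul_mul, add_mul, sub_mul, one_mul, mul_assoc, h1, mul_neg, neg_neg]
    module
  have zz : Pzero q s * Pzero q s = Pzero q s := by
    conv_lhs => enter [1]; rw [Pzero]
    simp only [Matrix.smul_mul, add_mul, sub_mul, one_mul, mul_assoc, h0, Matrix.mul_smul]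
    match_scalars
    field_simp
    ring
  have mz : Pminus q s * Pzero q s = 0 := by
    conv_lhs => enter [1]; rw [Pminus]
    simp only [Matrix.smul_mul, add_mul, sub_mul, one_mul, mul_assoc, h0, Matrix.mul_smul]
    module
  refine ⟨⟨mm, ?_, zz⟩, ⟨?_, ?_, mz, zm, ?_, ?_⟩, ?_, ?_⟩
  · simp [Pplus, mul_sub, sub_mul, mm, zz, mz, zm]
  · simp [Pplus, mul_sub, sub_mul, mm, zz, mz, zm]
  · simp [Pplus, mul_sub, sub_mul, mm, zz, mz, zm]
  · simp [Pplus, mul_sub, sub_mul, mm, zz, mz, zm]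
  · simp [Pplus, mul_sub, sub_mul, mm, zz, mz, zm]
  · simp only [Pplus]; abel
  · simp only [Pplus, Pminus, Pzero]
    match_scalars <;> field_simp <;> ring


end
end

section
/- Fix h ∈ ℂ. For real q > 0 with q ≠ 1 let g(q) be the 3×3 matrix [[1, 0, h/(q−1)], [0, 1, 0], [0, 0, 1]] and let C_q be the 3×3 matrix [[0, 0, −q^{−1/2}], [0, 1, 0], [q^{1/2}, 0, 0]] (with q^{1/2} the positive square root). Then, as q tends to 1 (within the positive reals, q ≠ 1), the matrix g(q)ᵀ·C_q·g(q) converges entrywise to the h-deformed metric C_h = [[0, 0, −1], [0, 1, 0], [1, 0, h]]. -/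
open Filter Topology Matrix

/-- The change-of-basis matrix `g(q)` (with new deformation parameter `h`). -/
noncomputable def gmat (h : ℂ) (q : ℝ) : Matrix (Fin 3) (Fin 3) ℂ :=
  !![1, 0, h / ((q : ℂ) - 1); 0, 1, 0; 0, 0, 1]

/-- The `q`-deformed metric `C_q`, with `q^{1/2}` the positive square root of `q`. -/
noncomputable def Cqmat (q : ℝ) : Matrix (Fin 3) (Fin 3) ℂ :=
  !![0, 0, -((Real.sqrt q : ℂ))⁻¹; 0, 1, 0; ((Real.sqrt q : ℂ)), 0, 0]

/-- As `q → 1` along `(0,∞) \ {1}`, the matrix `g(q)ᵀ·C_q·g(q)` converges (entrywise)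
to the `h`-deformed metric `C_h`. -/
theorem stmt15 (h : ℂ) :
    Tendsto (fun q : ℝ => (gmat h q)ᵀ * Cqmat q * gmat h q)
      (nhdsWithin 1 (Set.Ioi (0 : ℝ) \ {1}))
      (nhds (!![0, 0, -1; 0, 1, 0; 1, 0, h] : Matrix (Fin 3) (Fin 3) ℂ)) := by
  have key : ∀ q ∈ Set.Ioi (0 : ℝ) \ {1},
      (!![0, 0, -((Real.sqrt q : ℂ))⁻¹; 0, 1, 0;
        (Real.sqrt q : ℂ), 0, h * ((Real.sqrt q : ℂ))⁻¹] : Matrix (Fin 3) (Fin 3) ℂ)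
      = (gmat h q)ᵀ * Cqmat q * gmat h q := by
    rintro q ⟨hq, hq1⟩
    have hq0 : (0 : ℝ) < q := hq
    have hs : (Real.sqrt q : ℂ) ≠ 0 := by
      exact_mod_cast (Real.sqrt_pos.mpr hq0).ne'
    have hss : (Real.sqrt q : ℂ) ^ 2 = (q : ℂ) := by
      exact_mod_cast Real.sq_sqrt hq0.le
    have hd : (q : ℂ) - 1 ≠ 0 := by
      rw [sub_ne_zero]
      exact_mod_cast hq1
    ext i j
    fin_cases i <;> fin_cases j <;>
      simp [gmat, Cqmat, Matrix.mul_apply, Fin.sum_univ_three]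
    field_simp
    rw [hss]
    ring
  refine Tendsto.congr' (eventually_nhdsWithin_of_forall key) ?_
  have hc : Tendsto (fun q : ℝ => (Real.sqrt q : ℂ)) (nhdsWithin 1 (Set.Ioi (0 : ℝ) \ {1}))
      (nhds 1) := by
    have h1 : Continuous (fun q : ℝ => (Real.sqrt q : ℂ)) := by fun_prop
    have h2 := h1.tendsto 1
    simp only [Real.sqrt_one, Complex.ofReal_one] at h2
    exact h2.mono_left nhdsWithin_le_nhds
  have hi := hc.inv₀ one_ne_zero
  rw [inv_one] at hi
  have hh := hi.const_mul h
  rw [mul_one] at hh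
  refine tendsto_pi_nhds.mpr fun i => tendsto_pi_nhds.mpr fun j => ?_
  fin_cases i <;> fin_cases j <;>
    first
    | exact tendsto_const_nhds
    | exact hc
    | exact hi.neg
    | exact hh
end

section
/- Let A be an associative unital ℂ-algebra, h ∈ ℂ, and let (ξ, x, η) be a triple of elements of A satisfying the SP_h^{1|2}-relations. Then, regarded in the opposite algebra Aᵐᵒᵖ, the triple (ξ − h·η, i·x, η) (i the imaginary unit) satisfies the SP_{−h}^{1|2}-relations. (This encodes the statement that the hermitean conjugation ξ* = ξ − hη, x* = i·x, η* = η, with the order-reversing star and h̄ = −h, preserves the defining relations of the h-deformed symplectic superspace.) -/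
/-- A triple `(ξ, x, η)` in a unital associative ℂ-algebra `A` satisfies the
`SP_h^{1|2}`-relations of the `h`-deformed symplectic superspace. -/
def SPhRel {A : Type*} [Ring A] [Algebra ℂ A] (h : ℂ) (ξ x η : A) : Prop :=
  x * ξ = ξ * x + (2 * h) • (η * x) ∧
  x * η = η * x ∧
  ξ * η = -(η * ξ) ∧
  ξ ^ 2 = h • (x ^ 2 + (2 : ℂ) • (ξ * η)) ∧
  η ^ 2 = 0

/-- In the opposite algebra `Aᵐᵒᵖ` (encoding the hermitean conjugation
`ξ* = ξ − hη`, `x* = i·x`, `η* = η` with the order-reversing star and `h̄ = −h`),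
the triple `(ξ − h·η, i·x, η)` satisfies the `SP_{−h}^{1|2}`-relations. -/
theorem stmt17 {A : Type*} [Ring A] [Algebra ℂ A] (h : ℂ)
    (ξ x η : A) (hrel : SPhRel h ξ x η) :
    SPhRel (A := Aᵐᵒᵖ) (-h) (MulOpposite.op (ξ - h • η)) (MulOpposite.op (Complex.I • x))
      (MulOpposite.op η) := by
  obtain ⟨h1, h2, h3, h4, h5⟩ := hrel
  rw [pow_two] at h4 h5
  refine ⟨?_, ?_, ?_, ?_, ?_⟩ <;> apply MulOpposite.unop_injective <;>
    simp only [pow_two, MulOpposite.unop_mul, MulOpposite.unop_op, MulOpposite.unop_add,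
      MulOpposite.unop_smul, MulOpposite.unop_neg, MulOpposite.unop_zero, sub_mul, mul_sub,
      smul_mul_assoc, mul_smul_comm, h1, h2, h3, h4, h5, smul_smul, smul_zero, sub_zero,
      Complex.I_mul_I]
  · module
  · module
  · module
end

section
/- Let A be an associative unital ℂ-algebra, h ∈ ℂ, and let (ξ, x, η) be a triple of elements of A satisfying the SP_h^{1|2}-relations. Then the h-deformed supersphere ρ := x² + 2·ξ·η commutes with each of ξ, x and η, and satisfies h·ρ = ξ² (so ρ = h⁻¹·ξ² whenever h ≠ 0). -/
theorem stmt18 {A : Type*} [Ring A] [Algebra ℂ A] (h : ℂ)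
    (ξ x η : A) (hrel : SPhRel h ξ x η)
    (ρ : A) (hρ : ρ = x ^ 2 + (2 : ℂ) • (ξ * η)) :
    Commute ρ ξ ∧ Commute ρ x ∧ Commute ρ η ∧ h • ρ = ξ ^ 2 := by
  obtain ⟨h1, h2, h3, h4, h5⟩ := hrel
  have hηη : η * η = 0 := by rw [← pow_two]; exact h5
  have hx2 : x ^ 2 * η = η * x ^ 2 := by
    rw [pow_two, mul_assoc, h2, ← mul_assoc, h2, mul_assoc]
  have e1 : ξ ^ 2 * η = h • (η * x ^ 2) := by
    rw [h4, smul_mul_assoc, add_mul, smul_mul_assoc, mul_assoc ξ, hηη, mul_zero,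
      smul_zero, add_zero, hx2]
  have e2 : ξ * η * ξ = -(h • (η * x ^ 2)) := by
    have : η * ξ = -(ξ * η) := by rw [h3, neg_neg]
    rw [mul_assoc, this, mul_neg, ← mul_assoc, ← pow_two, e1]
  have e3 : x ^ 2 * ξ = ξ * x ^ 2 + (4 * h) • (η * x ^ 2) := by
    have a : x * (ξ * x) = ξ * x ^ 2 + (2 * h) • (η * x ^ 2) := by
      rw [← mul_assoc, h1, add_mul, smul_mul_assoc, mul_assoc, mul_assoc, ← pow_two]
    have b : x * (η * x) = η * x ^ 2 := by
      rw [← mul_assoc, h2, mul_assoc, ← pow_two]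
    rw [pow_two, mul_assoc, h1, mul_add, mul_smul_comm, a, b, ← pow_two]
    module
  have e4 : x * (ξ * η) = ξ * η * x := by
    rw [← mul_assoc, h1, add_mul, smul_mul_assoc, mul_assoc η, h2, ← mul_assoc η, hηη,
      zero_mul, smul_zero, add_zero, mul_assoc, h2, mul_assoc]
  have e5 : η * (ξ * η) = 0 := by
    have : η * ξ = -(ξ * η) := by rw [h3, neg_neg]
    rw [← mul_assoc, this, neg_mul, mul_assoc, hηη, mul_zero, neg_zero]
  subst hρ
  refine ⟨?_, ?_, ?_, h4.symm⟩
  · change _ * _ = _ * _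
    rw [add_mul, mul_add, smul_mul_assoc, mul_smul_comm, e2, e3, ← mul_assoc ξ ξ,
      ← pow_two ξ, e1]
    module
  · change _ * _ = _ * _
    rw [add_mul, mul_add, smul_mul_assoc, mul_smul_comm, e4, ← pow_succ, ← pow_succ']
  · change _ * _ = _ * _
    rw [add_mul, mul_add, smul_mul_assoc, mul_smul_comm, e5, mul_assoc, hηη, mul_zero, hx2]
end
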